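/- For n : ℕ, let U n denote the number of up-down permutations of length n, i.e., the cardinality of the set of bijections a : Fin n ≃ Fin n satisfying a(i) < a(i+1) whenever i is even and a(i) > a(i+1) whenever i is odd (for all valid indices i with i+1 < n). Then for every natural number n ≥ 1, ∑_{j=0}^{n−1} binomial(2n−1, 2j) · (−1)ʲ · U(2j) = (−1)^{n−1} · U(2n−1) (as an identity in ℤ, with values of U cast from ℕ). -/

import Mathlib

/-- The number of up-down permutations of length `n`: bijections `a : Fin n ≃ Fin n`
with `a 0 < a 1 > a 2 < a 3 > ⋯`. -/
noncomputable def upDownCount (n : ℕ) : ℕ :=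
  Nat.card {a : Fin n ≃ Fin n //
    ∀ i : ℕ, (h : i + 1 < n) →
      (Even i → a ⟨i, Nat.lt_of_succ_lt h⟩ < a ⟨i + 1, h⟩) ∧
      (Odd i → a ⟨i + 1, h⟩ < a ⟨i, Nat.lt_of_succ_lt h⟩)}

/-- The number of permutations of `Fin m` whose set of descents is
`{i | i + 1 < m ∧ p i}`. -/
noncomputable def descentCount (m : ℕ) (p : ℕ → Prop) : ℕ :=
  Nat.card {a : Fin m ≃ Fin m //
    ∀ i : ℕ, (h : i + 1 < m) → (a ⟨i + 1, h⟩ < a ⟨i, Nat.lt_of_succ_lt h⟩ ↔ p i)}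

theorem descentCount_congr {m : ℕ} {p q : ℕ → Prop} (h : ∀ i, i + 1 < m → (p i ↔ q i)) :
    descentCount m p = descentCount m q :=
  Nat.card_congr <| Equiv.subtypeEquivRight fun _ =>
    forall₂_congr fun i hi => by rw [h i hi]

theorem upDownCount_eq_descentCount (n : ℕ) : upDownCount n = descentCount n Odd := by
  refine Nat.card_congr <| Equiv.subtypeEquivRight fun a => forall₂_congr fun i h => ?_
  have hne : a ⟨i, Nat.lt_of_succ_lt h⟩ ≠ a ⟨i + 1, h⟩ := fun he => by
    simpa using a.injective he
  rcases Nat.even_or_odd i with hi | hi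
  · have hi' := Nat.not_odd_iff_even.2 hi
    simp only [hi, hi', iff_false, not_lt, true_imp_iff, false_imp_iff, and_true]
    exact hne.le_iff_lt.symm
  · have hi' := Nat.not_even_iff_odd.2 hi
    simp [hi, hi']

/-- The permutation of `Fin (k + l)` sending the first `k` positions to `s`, in the relative
order prescribed by `b`, and the last `l` positions increasingly to the complement of `s`. -/
def shufflePerm {k l : ℕ} (s : Finset (Fin (k + l))) (hs : s.card = k) (hs' : sᶜ.card = l)
    (b : Fin k ≃ Fin k) : Fin (k + l) ≃ Fin (k + l) :=
  finSumFinEquiv.symm.trans ((Equiv.sumCongr b (Equiv.refl _)).trans (finSumEquivOfFinset hs hs'))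

section shufflePerm

variable {k l : ℕ} (s : Finset (Fin (k + l))) (hs : s.card = k) (hs' : sᶜ.card = l)
  (b : Fin k ≃ Fin k)

theorem shufflePerm_castAdd (i : Fin k) :
    shufflePerm s hs hs' b (Fin.castAdd l i) = s.orderEmbOfFin hs (b i) := by
  simp [shufflePerm]

theorem shufflePerm_natAdd (i : Fin l) :
    shufflePerm s hs hs' b (Fin.natAdd k i) = sᶜ.orderEmbOfFin hs' i := by
  simp [shufflePerm]

theorem image_shufflePerm_castAdd :
    Finset.univ.image (fun i : Fin k => shufflePerm s hs hs' b (Fin.castAdd l i)) = s := by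
  apply Finset.coe_injective
  simp only [shufflePerm_castAdd, Finset.coe_image, Finset.coe_univ, Set.image_univ]
  rw [← s.range_orderEmbOfFin hs]
  exact b.surjective.range_comp (s.orderEmbOfFin hs)

end shufflePerm

theorem choose_mul_descentCount (k l : ℕ) (p : ℕ → Prop) :
    (k + l).choose k * descentCount k p =
      Nat.card {a : Fin (k + l) ≃ Fin (k + l) // ∀ i : ℕ, (h : i + 1 < k + l) → i + 1 ≠ k →
        (a ⟨i + 1, h⟩ < a ⟨i, Nat.lt_of_succ_lt h⟩ ↔ p i ∧ i + 1 < k)} := by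
  have hcompl : ∀ s : Finset (Fin (k + l)), s.card = k → sᶜ.card = l := fun s hs => by
    rw [Finset.card_compl, hs, Fintype.card_fin, Nat.add_sub_cancel_left]
  have hchoose : (k + l).choose k = Nat.card {s : Finset (Fin (k + l)) // s.card = k} := by
    rw [Nat.card_eq_fintype_card, Fintype.card_finset_len, Fintype.card_fin]
  rw [hchoose, descentCount, ← Nat.card_prod]
  refine Nat.card_eq_of_bijective
    (fun x => ⟨shufflePerm x.1.1 x.1.2 (hcompl _ x.1.2) x.2.1, fun i h hik => ?_⟩) ⟨?_, ?_⟩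
  · obtain ⟨⟨s, hs⟩, b, hb⟩ := x
    rcases lt_or_gt_of_ne hik with hlt | hgt
    · have h₁ := shufflePerm_castAdd s hs (hcompl s hs) b ⟨i, by omega⟩
      have h₂ := shufflePerm_castAdd s hs (hcompl s hs) b ⟨i + 1, hlt⟩
      simp only [Fin.castAdd_mk] at h₁ h₂
      simp [h₁, h₂, hb i hlt, hlt]
    · obtain ⟨j, rfl⟩ : ∃ j, i = k + j := ⟨i - k, by omega⟩
      have h₁ := shufflePerm_natAdd s hs (hcompl s hs) b ⟨j, by omega⟩
      have h₂ := shufflePerm_natAdd s hs (hcompl s hs) b ⟨j + 1, by omega⟩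
      simp only [Fin.natAdd_mk, ← add_assoc] at h₁ h₂
      simp only [h₁, h₂, OrderEmbedding.lt_iff_lt, Fin.mk_lt_mk]
      omega
  · rintro ⟨⟨s, hs⟩, b, hb⟩ ⟨⟨t, ht⟩, c, hc⟩ h
    have h' : shufflePerm s hs (hcompl s hs) b = shufflePerm t ht (hcompl t ht) c :=
      congrArg Subtype.val h
    obtain rfl : s = t := by
      rw [← image_shufflePerm_castAdd s hs (hcompl s hs) b, h', image_shufflePerm_castAdd]
    obtain rfl : b = c := Equiv.ext fun i => by
      have hi := congrArg (· (Fin.castAdd l i)) h'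
      simpa [shufflePerm_castAdd] using hi
    rfl
  · rintro ⟨a, ha⟩
    have hinj : Function.Injective fun i : Fin k => a (Fin.castAdd l i) :=
      a.injective.comp (Fin.castAdd_injective k l)
    obtain ⟨s, hs_def⟩ : ∃ s, s = Finset.univ.image fun i : Fin k => a (Fin.castAdd l i) :=
      ⟨_, rfl⟩
    have hs : s.card = k := by
      rw [hs_def, Finset.card_image_of_injective _ hinj, Finset.card_univ, Fintype.card_fin]
    have hmem : ∀ i : Fin k, a (Fin.castAdd l i) ∈ s := fun i => by
      rw [hs_def]
      exact Finset.mem_image_of_mem _ (Finset.mem_univ i)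
    let f : Fin k → Fin k := fun i => (s.orderIsoOfFin hs).symm ⟨a (Fin.castAdd l i), hmem i⟩
    have hf : Function.Injective f := fun i j hij => by
      simpa [f] using hij
    let b : Fin k ≃ Fin k := Equiv.ofBijective f (Finite.injective_iff_bijective.1 hf)
    have hb : ∀ i, s.orderEmbOfFin hs (b i) = a (Fin.castAdd l i) := fun i => by
      rw [← Finset.coe_orderIsoOfFin_apply]
      simp [b, f]
    have hmono : StrictMono fun i : Fin l => a (Fin.natAdd k i) := by
      rcases l with _ | l
      · exact fun i => i.elim0
      · refine Fin.strictMono_iff_lt_succ.2 fun i => ?_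
        have hi := (ha (k + i) (by omega) (by omega)).not.2 (by omega)
        refine lt_of_le_of_ne (not_lt.1 hi) fun he => ?_
        have := congrArg Fin.val (a.injective he)
        simp at this
    have hnot : ∀ i : Fin l, a (Fin.natAdd k i) ∈ sᶜ := fun i => by
      rw [Finset.mem_compl, hs_def]
      simp only [Finset.mem_image, Finset.mem_univ, true_and, not_exists]
      intro j hj
      have := congrArg Fin.val (a.injective hj)
      simp only [Fin.val_castAdd, Fin.val_natAdd] at this
      omega
    have hright := Finset.orderEmbOfFin_unique (hcompl s hs) hnot hmono
    refine ⟨⟨⟨s, hs⟩, b, fun i h => ?_⟩, Subtype.ext (Equiv.ext fun i => ?_)⟩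
    · rw [← (s.orderEmbOfFin hs).lt_iff_lt, hb, hb]
      simpa [h] using ha i (by omega) (by omega)
    · refine Fin.addCases (fun i => ?_) (fun i => ?_) i
      · exact (shufflePerm_castAdd s hs (hcompl s hs) b i).trans (hb i)
      · exact (shufflePerm_natAdd s hs (hcompl s hs) b i).trans (congrFun hright i).symm

/-- Leaving the comparison at one position free splits the permutations according to whether
there is an ascent or a descent there. -/
theorem card_descents_except (m r : ℕ) (hr : r + 1 < m) (p : ℕ → Prop) :
    Nat.card {a : Fin m ≃ Fin m // ∀ i : ℕ, (h : i + 1 < m) → i ≠ r →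
        (a ⟨i + 1, h⟩ < a ⟨i, Nat.lt_of_succ_lt h⟩ ↔ p i)} =
      descentCount m (fun i => p i ∧ i ≠ r) + descentCount m (fun i => p i ∨ i = r) := by
  classical
  rw [descentCount, descentCount, ← Nat.card_sum]
  refine Nat.card_congr (Equiv.trans ?_ (subtypeOrEquiv _ _ ?_))
  · refine Equiv.subtypeEquivRight fun a => ⟨fun ha => ?_, ?_⟩
    · by_cases har : a ⟨r + 1, hr⟩ < a ⟨r, Nat.lt_of_succ_lt hr⟩
      · right
        intro i h
        by_cases hi : i = r
        · subst hi; simp [har]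
        · simp [hi, ha i h hi]
      · left
        intro i h
        by_cases hi : i = r
        · subst hi; simpa using har
        · simp [hi, ha i h hi]
    · rintro (ha | ha) i h hi <;> simp [ha i h, hi]
  · rw [Pi.disjoint_iff]
    intro a
    rw [Prop.disjoint_iff, not_and]
    intro h₁ h₂
    simpa using (h₁ r hr).symm.trans (h₂ r hr)

theorem choose_mul_upDownCount_zero (m : ℕ) :
    m.choose 0 * upDownCount 0 = descentCount m (fun i => Odd i ∧ i + 1 < 2) := by
  obtain ⟨l, rfl⟩ : ∃ l, m = 0 + l := ⟨m, (Nat.zero_add m).symm⟩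
  rw [upDownCount_eq_descentCount, choose_mul_descentCount]
  refine Nat.card_congr <| Equiv.subtypeEquivRight fun a => forall₂_congr fun i h => ?_
  have hiff : (Odd i ∧ i + 1 < 0) ↔ (Odd i ∧ i + 1 < 2) := by
    simp only [Nat.odd_iff]; omega
  simp only [ne_eq, Nat.succ_ne_zero, not_false_eq_true, true_imp_iff, hiff]

theorem choose_mul_upDownCount_even (m j : ℕ) (hj : 1 ≤ j) (hjm : 2 * j < m) :
    m.choose (2 * j) * upDownCount (2 * j) =
      descentCount m (fun i => Odd i ∧ i + 1 < 2 * j) +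
        descentCount m (fun i => Odd i ∧ i + 1 < 2 * (j + 1)) := by
  obtain ⟨l, rfl⟩ := Nat.exists_eq_add_of_le hjm.le
  rw [upDownCount_eq_descentCount, choose_mul_descentCount]
  have h := card_descents_except (2 * j + l) (2 * j - 1) (by omega)
    (fun i => Odd i ∧ i + 1 < 2 * j)
  have hne : ∀ i, i + 1 ≠ 2 * j ↔ i ≠ 2 * j - 1 := fun i => by omega
  simp only [hne]
  rw [h]
  congr 1 <;> refine descentCount_congr fun i _ => ?_ <;> simp only [Nat.odd_iff] <;> omega

/-- For `n ≥ 1`, `∑_{j=0}^{n-1} C(2n-1, 2j) * (-1)^j * U (2j) = (-1)^(n-1) * U (2n-1)`,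
where `U` counts up-down permutations. -/
theorem upDownCount_alternating_sum_odd (n : ℕ) (hn : 1 ≤ n) :
    ∑ j ∈ Finset.range n,
      ((2 * n - 1).choose (2 * j) : ℤ) * (-1) ^ j * (upDownCount (2 * j) : ℤ) =
      (-1) ^ (n - 1) * (upDownCount (2 * n - 1) : ℤ) := by
  have hpartial : ∀ N, 1 ≤ N → N ≤ n → ∑ j ∈ Finset.range N,
      ((2 * n - 1).choose (2 * j) : ℤ) * (-1) ^ j * (upDownCount (2 * j) : ℤ) =
      (-1) ^ (N - 1) * (descentCount (2 * n - 1) fun i => Odd i ∧ i + 1 < 2 * N : ℕ) := by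
    intro N hN
    induction N, hN using Nat.le_induction with
    | base =>
      intro _
      have h := choose_mul_upDownCount_zero (2 * n - 1)
      simpa using congrArg (Nat.cast : ℕ → ℤ) h
    | succ N hN ih =>
      intro hNn
      have h := congrArg (Nat.cast : ℕ → ℤ)
        (choose_mul_upDownCount_even (2 * n - 1) N hN (by omega))
      push_cast at h
      rw [Finset.sum_range_succ, ih (by omega), mul_right_comm, h]
      obtain ⟨M, rfl⟩ := Nat.exists_eq_add_of_le' hN
      simp only [Nat.add_sub_cancel, pow_succ]
      ring
  rw [hpartial n hn le_rfl, upDownCount_eq_descentCount]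
  congr 2
  exact descentCount_congr fun i hi => and_iff_left (by omega)
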